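/- arXiv:math/9306208 — 3 statements merged into one kernel-verified Lean document; each statement's English description precedes it below -/
import Mathlib

section
/- Let $E$ and $F$ be real Banach spaces, $p>1$, $(X,\sigma)$ a finite measure space, and $T$ a linear isometry from $E$ into the Lebesgue–Bochner space $L_p(X;F)$. If $e,f\in E$ satisfy $\|e\|=\|f\|=1$ and have a common tangent functional (there exists $x^*\in E^*$ with $\|x^*\|=1$ and $x^*(e)=x^*(f)=1$), then $\int_X \|Te(x)\|^{p-1}\,\|Tf(x)\|\,d\sigma(x) \geq 1$. -/
open MeasureTheory

/-- The `p`-th power of the norm of an `L_p` function is the integral of `‖g‖ ^ p`. -/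
lemma Lp_norm_rpow_eq_integral {F X : Type*} [NormedAddCommGroup F]
    [MeasurableSpace X] {σ : Measure X} {p : ℝ} (hp : 0 < p)
    (g : Lp F (ENNReal.ofReal p) σ) :
    ∫ x, ‖g x‖ ^ p ∂σ = ‖g‖ ^ p := by
  have h0 : ENNReal.ofReal p ≠ 0 := by simpa using hp
  have h := (Lp.memLp g).eLpNorm_eq_integral_rpow_norm h0 ENNReal.ofReal_ne_top
  have hnn : 0 ≤ ∫ x, ‖g x‖ ^ p ∂σ := integral_nonneg fun x => by positivity
  rw [ENNReal.toReal_ofReal hp.le] at h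
  rw [Lp.norm_def, h, ENNReal.toReal_ofReal (by positivity), Real.rpow_inv_rpow hnn hp.ne']

/-- The function `‖g‖ ^ p` is integrable for `g` in `L_p`. -/
lemma Lp_integrable_norm_rpow {F X : Type*} [NormedAddCommGroup F]
    [MeasurableSpace X] {σ : Measure X} {p : ℝ} (hp : 0 < p)
    (g : Lp F (ENNReal.ofReal p) σ) :
    Integrable (fun x => ‖g x‖ ^ p) σ := by
  have h0 : ENNReal.ofReal p ≠ 0 := by simpa using hp
  simpa [ENNReal.toReal_ofReal hp.le] using
    (Lp.memLp g).integrable_norm_rpow h0 ENNReal.ofReal_ne_top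

/-- Midpoint convexity of `t ↦ t ^ p`, evaluated at norms. -/
lemma norm_add_div_two_rpow_le {F : Type*} [NormedAddCommGroup F] {p : ℝ} (hp : 1 < p)
    (u v : F) : (‖u + v‖ / 2) ^ p ≤ (‖u‖ ^ p + ‖v‖ ^ p) / 2 := by
  have h := (convexOn_rpow hp.le).2 (norm_nonneg u) (norm_nonneg v)
    (by norm_num : (0 : ℝ) ≤ 1 / 2) (by norm_num : (0 : ℝ) ≤ 1 / 2) (by norm_num)
  simp only [smul_eq_mul] at h
  have h2 : (‖u + v‖ / 2) ^ p ≤ (1 / 2 * ‖u‖ + 1 / 2 * ‖v‖) ^ p := by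
    gcongr
    linarith [norm_add_le u v]
  linarith

/-- The equality case of midpoint convexity forces equal norms. -/
lemma norm_eq_of_norm_add_div_two_rpow_eq {F : Type*} [NormedAddCommGroup F] {p : ℝ}
    (hp : 1 < p) {u v : F} (huv : (‖u + v‖ / 2) ^ p = (‖u‖ ^ p + ‖v‖ ^ p) / 2) :
    ‖u‖ = ‖v‖ := by
  by_contra hne
  have h := (strictConvexOn_rpow hp).2 (norm_nonneg u) (norm_nonneg v) hne
    (by norm_num : (0 : ℝ) < 1 / 2) (by norm_num : (0 : ℝ) < 1 / 2) (by norm_num)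
  simp only [smul_eq_mul] at h
  have h2 : (‖u + v‖ / 2) ^ p ≤ (1 / 2 * ‖u‖ + 1 / 2 * ‖v‖) ^ p := by
    gcongr
    linarith [norm_add_le u v]
  linarith

/-- Unit vectors of `L_p` whose sum has norm two have almost everywhere equal norms. -/
lemma Lp_norm_ae_eq_of_norm_add_eq_two {F X : Type*} [NormedAddCommGroup F]
    [MeasurableSpace X] {σ : Measure X} {p : ℝ} (hp : 1 < p)
    {g h : Lp F (ENNReal.ofReal p) σ} (hg : ‖g‖ = 1) (hh : ‖h‖ = 1) (hgh : ‖g + h‖ = 2) :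
    ∀ᵐ x ∂σ, ‖g x‖ = ‖h x‖ := by
  have hp0 : 0 < p := by linarith
  have ig := Lp_integrable_norm_rpow hp0 g
  have ih := Lp_integrable_norm_rpow hp0 h
  have hdiv : ∀ x, (‖(g + h) x‖ / 2) ^ p = ‖(g + h) x‖ ^ p / 2 ^ p := fun x =>
    Real.div_rpow (norm_nonneg _) (by norm_num) p
  have is : Integrable (fun x => (‖(g + h) x‖ / 2) ^ p) σ := by
    simpa only [hdiv] using (Lp_integrable_norm_rpow hp0 (g + h)).div_const (2 ^ p)
  have igh : Integrable (fun x => (‖g x‖ ^ p + ‖h x‖ ^ p) / 2) σ := (ig.add ih).div_const 2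
  have hadd := Lp.coeFn_add g h
  have hle : (fun x => (‖(g + h) x‖ / 2) ^ p) ≤ᵐ[σ] fun x => (‖g x‖ ^ p + ‖h x‖ ^ p) / 2 := by
    filter_upwards [hadd] with x hx
    rw [hx]
    exact norm_add_div_two_rpow_le hp _ _
  have hint : ∫ x, (‖(g + h) x‖ / 2) ^ p ∂σ = ∫ x, (‖g x‖ ^ p + ‖h x‖ ^ p) / 2 ∂σ := by
    simp only [hdiv]
    rw [integral_div, integral_div, integral_add ig ih, Lp_norm_rpow_eq_integral hp0,
      Lp_norm_rpow_eq_integral hp0, Lp_norm_rpow_eq_integral hp0, hg, hh, hgh,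
      div_self (by positivity)]
    norm_num
  filter_upwards [(integral_eq_iff_of_ae_le is igh hle).1 hint, hadd] with x hx hax
  rw [hax] at hx
  exact norm_eq_of_norm_add_div_two_rpow_eq hp hx

/-- Unit vectors with a common tangent functional have a sum of norm two. -/
lemma norm_add_eq_two_of_common_tangent {E : Type*} [NormedAddCommGroup E] [NormedSpace ℝ E]
    {e f : E} (he : ‖e‖ = 1) (hf : ‖f‖ = 1) {φ : E →L[ℝ] ℝ} (hφ : ‖φ‖ = 1)
    (hφe : φ e = 1) (hφf : φ f = 1) : ‖e + f‖ = 2 := by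
  have h1 := norm_add_le e f
  have h2 := (le_abs_self _).trans (φ.le_opNorm (e + f))
  rw [map_add, hφe, hφf, hφ] at h2
  linarith

/-- If unit vectors `e, f` of a Banach space `E` have a common tangent functional,
then any linear isometry `T : E → L_p(X; F)` (with `p > 1`, `σ` finite) satisfies
`∫ ‖Te(x)‖^(p-1) ‖Tf(x)‖ dσ(x) ≥ 1`. -/
theorem holder_lower_bound
    {E F : Type*} [NormedAddCommGroup E] [NormedSpace ℝ E] [CompleteSpace E]
    [NormedAddCommGroup F] [NormedSpace ℝ F] [CompleteSpace F]
    {X : Type*} [MeasurableSpace X] (σ : Measure X) [IsFiniteMeasure σ]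
    {p : ℝ} (hp : 1 < p) [Fact (1 ≤ ENNReal.ofReal p)]
    (T : E →ₗᵢ[ℝ] Lp F (ENNReal.ofReal p) σ)
    (e f : E) (he : ‖e‖ = 1) (hf : ‖f‖ = 1)
    (x' : E →L[ℝ] ℝ) (hx' : ‖x'‖ = 1) (hx'e : x' e = 1) (hx'f : x' f = 1) :
    1 ≤ ∫ x, ‖T e x‖ ^ (p - 1) * ‖T f x‖ ∂σ := by
  have hp0 : 0 < p := by linarith
  have hTe : ‖T e‖ = 1 := by rw [T.norm_map, he]
  have hTf : ‖T f‖ = 1 := by rw [T.norm_map, hf]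
  have hadd : ‖T e + T f‖ = 2 := by
    rw [← map_add, T.norm_map, norm_add_eq_two_of_common_tangent he hf hx' hx'e hx'f]
  have hae : (fun x => ‖T e x‖ ^ (p - 1) * ‖T f x‖) =ᵐ[σ] fun x => ‖T e x‖ ^ p := by
    filter_upwards [Lp_norm_ae_eq_of_norm_add_eq_two hp hTe hTf hadd] with x hx
    rw [← hx, ← Real.rpow_add_one' (norm_nonneg _) (by linarith), sub_add_cancel]
  rw [integral_congr_ae hae, Lp_norm_rpow_eq_integral hp0, hTe, Real.one_rpow]
end

section
/- Let $p>1$, $K$ a compact metric space, $(X,\sigma)$ a finite measure space, $F$ a real Banach space, and let $E$ be a closed subspace of $C(K)$ containing the constant function $1$. If $T$ is a linear isometry from $E$ into the Lebesgue–Bochner space $L_p(X;F)$, then for every $e\in E$ one has $\|Te(x)\|=\|T1(x)\|\cdot\|e\|$ for $\sigma$-almost all $x\in X$. -/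
open MeasureTheory

theorem MeasureTheory.Lp.norm_rpow_eq_integral
    {F X : Type*} [NormedAddCommGroup F] [MeasurableSpace X] {σ : Measure X}
    {p : ℝ} (hp : 0 < p) (f : Lp F (ENNReal.ofReal p) σ) :
    ‖f‖ ^ p = ∫ x, ‖f x‖ ^ p ∂σ := by
  have hnonneg : 0 ≤ ∫ x, ‖f x‖ ^ p ∂σ := integral_nonneg fun x => by positivity
  rw [Lp.norm_def, (Lp.memLp f).eLpNorm_eq_integral_rpow_norm (by simpa using hp)
    ENNReal.ofReal_ne_top, ENNReal.toReal_ofReal hp.le,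
    ENNReal.toReal_ofReal (by positivity), ← Real.rpow_mul hnonneg,
    inv_mul_cancel₀ hp.ne', Real.rpow_one]

theorem MeasureTheory.Lp.integrable_norm_rpow_coeFn
    {F X : Type*} [NormedAddCommGroup F] [MeasurableSpace X] {σ : Measure X}
    {p : ℝ} (hp : 0 < p) (f : Lp F (ENNReal.ofReal p) σ) :
    Integrable (fun x => ‖f x‖ ^ p) σ := by
  have h := (Lp.memLp f).integrable_norm_rpow (by simpa using hp) ENNReal.ofReal_ne_top
  simpa only [ENNReal.toReal_ofReal hp.le] using h

/-- For unit vectors of `L_p` with `p > 1`, equality in the triangle inequality forces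
the pointwise norms to agree almost everywhere. -/
theorem MeasureTheory.Lp.ae_norm_eq_of_norm_add_eq_two
    {F X : Type*} [NormedAddCommGroup F] [MeasurableSpace X] {σ : Measure X}
    {p : ℝ} (hp : 1 < p) (f g : Lp F (ENNReal.ofReal p) σ)
    (hf : ‖f‖ = 1) (hg : ‖g‖ = 1) (hfg : ‖f + g‖ = 2) :
    ∀ᵐ x ∂σ, ‖f x‖ = ‖g x‖ := by
  have hp0 : 0 < p := by linarith
  have hle : ∀ᵐ x ∂σ, ‖(f + g) x‖ ≤ ‖f x‖ + ‖g x‖ := by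
    filter_upwards [Lp.coeFn_add f g] with x hx
    rw [hx]
    exact norm_add_le _ _
  have hconv := strictConvexOn_rpow hp
  have hmid : ∀ a b c : ℝ, 0 ≤ a → 0 ≤ b → 0 ≤ c → c ≤ a + b →
      c ^ p / 2 ^ p ≤ ((2 : ℝ)⁻¹ * a + 2⁻¹ * b) ^ p := by
    intro a b c ha hb hc hcab
    rw [← Real.div_rpow hc zero_le_two]
    exact Real.rpow_le_rpow (by positivity) (by linarith) hp0.le
  let h : X → ℝ := fun x =>
    (2⁻¹ * ‖f x‖ ^ p + 2⁻¹ * ‖g x‖ ^ p) - ‖(f + g) x‖ ^ p / 2 ^ p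
  have hfi := (Lp.integrable_norm_rpow_coeFn hp0 f).const_mul 2⁻¹
  have hgi := (Lp.integrable_norm_rpow_coeFn hp0 g).const_mul 2⁻¹
  have hsi := (Lp.integrable_norm_rpow_coeFn hp0 (f + g)).div_const (2 ^ p)
  have h_nonneg : 0 ≤ᵐ[σ] h := by
    filter_upwards [hle] with x hx
    have h₁ := hmid _ _ _ (norm_nonneg (f x)) (norm_nonneg (g x)) (norm_nonneg _) hx
    have h₂ := hconv.convexOn.2 (norm_nonneg (f x)) (norm_nonneg (g x))
      (by norm_num : (0 : ℝ) ≤ 2⁻¹) (by norm_num : (0 : ℝ) ≤ 2⁻¹) (by norm_num)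
    simp only [smul_eq_mul] at h₂
    exact sub_nonneg.2 (h₁.trans h₂)
  have h_int : ∫ x, h x ∂σ = 0 := by
    rw [integral_sub (f := fun x => 2⁻¹ * ‖f x‖ ^ p + 2⁻¹ * ‖g x‖ ^ p) (hfi.add hgi) hsi,
      integral_add hfi hgi, integral_const_mul,
      integral_const_mul, integral_div, ← Lp.norm_rpow_eq_integral hp0,
      ← Lp.norm_rpow_eq_integral hp0, ← Lp.norm_rpow_eq_integral hp0, hf, hg, hfg,
      div_self (by positivity), Real.one_rpow]
    norm_num
  have h_zero := (integral_eq_zero_iff_of_nonneg_ae h_nonneg ((hfi.add hgi).sub hsi)).1 h_int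
  filter_upwards [h_zero, hle] with x hx hx'
  by_contra hne
  have h₁ := hmid _ _ _ (norm_nonneg (f x)) (norm_nonneg (g x)) (norm_nonneg _) hx'
  have h₂ := hconv.2 (norm_nonneg (f x)) (norm_nonneg (g x)) hne
    (by norm_num : (0 : ℝ) < 2⁻¹) (by norm_num : (0 : ℝ) < 2⁻¹) (by norm_num)
  simp only [smul_eq_mul] at h₂
  exact (sub_pos.2 (h₁.trans_lt h₂)).ne' hx

/-- A continuous function of norm one on a compact space satisfies `‖1 + e‖ = 2` or
`‖1 - e‖ = 2`. -/
theorem ContinuousMap.norm_one_add_or_sub_eq_two {K : Type*} [TopologicalSpace K]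
    [CompactSpace K] (e : C(K, ℝ)) (he : ‖e‖ = 1) : ‖1 + e‖ = 2 ∨ ‖1 + -e‖ = 2 := by
  have : Nonempty K := by
    by_contra hK
    rw [not_nonempty_iff] at hK
    have : e = 0 := by ext x; exact hK.elim x
    simp [this] at he
  obtain ⟨k, -, hk⟩ := isCompact_univ.exists_isMaxOn Set.univ_nonempty
    (e.continuous.norm.continuousOn (s := Set.univ))
  have hk1 : |e k| = 1 := by
    refine le_antisymm (he ▸ e.norm_coe_le_norm k) ?_
    rw [← he]
    exact (e.norm_le (abs_nonneg _)).2 fun x => hk (Set.mem_univ x)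
  have key : ∀ g : C(K, ℝ), ‖g‖ = 1 → g k = 1 → ‖1 + g‖ = 2 := by
    intro g hg hgk
    apply le_antisymm
    · refine (norm_add_le _ _).trans ?_
      rw [hg, norm_one]
      norm_num
    · have := (1 + g).norm_coe_le_norm k
      rw [ContinuousMap.add_apply, hgk, ContinuousMap.one_apply] at this
      norm_num at this
      exact this
  rcases (abs_eq zero_le_one).1 hk1 with h | h
  · exact Or.inl (key e he h)
  · exact Or.inr (key (-e) (by rwa [norm_neg]) (by simp [h]))

/-- If `E` is a closed subspace of `C(K)` containing the constant function `1`
and `T : E → L_p(X; F)` is a linear isometry with `p > 1` and `σ` finite, then for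
every `e ∈ E`, `‖Te(x)‖ = ‖T1(x)‖ ‖e‖` for `σ`-a.e. `x`. -/
theorem norm_eq_of_subspace_C_K
    {K : Type*} [MetricSpace K] [CompactSpace K]
    {F : Type*} [NormedAddCommGroup F] [NormedSpace ℝ F] [CompleteSpace F]
    {X : Type*} [MeasurableSpace X] (σ : Measure X) [IsFiniteMeasure σ]
    {p : ℝ} (hp : 1 < p) [Fact (1 ≤ ENNReal.ofReal p)]
    (E : Subspace ℝ C(K, ℝ)) (hE : IsClosed (E : Set C(K, ℝ)))
    (h1 : (1 : C(K, ℝ)) ∈ E)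
    (T : E →ₗᵢ[ℝ] Lp F (ENNReal.ofReal p) σ) :
    ∀ e : E, ∀ᵐ x ∂σ, ‖T e x‖ = ‖T (⟨1, h1⟩ : E) x‖ * ‖e‖ := by
  intro e
  rcases eq_or_ne e 0 with rfl | he
  · rw [T.map_zero]
    filter_upwards [Lp.coeFn_zero F (ENNReal.ofReal p) σ] with x hx
    rw [hx, Pi.zero_apply, norm_zero, Submodule.coe_norm, ZeroMemClass.coe_zero, norm_zero,
      mul_zero]
  have he' : ‖e‖ ≠ 0 := norm_ne_zero_iff.2 he
  have : Nonempty K := by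
    by_contra hK
    rw [not_nonempty_iff] at hK
    exact he (Subtype.ext (by ext x; exact hK.elim x))
  have hone : ‖T (⟨1, h1⟩ : E)‖ = 1 := by
    rw [T.norm_map]
    exact norm_one (α := C(K, ℝ))
  have key : ∀ u : E, ‖u‖ = 1 → ‖(1 : C(K, ℝ)) + u‖ = 2 →
      ∀ᵐ x ∂σ, ‖T (⟨1, h1⟩ : E) x‖ = ‖T u x‖ := by
    intro u hu hu2
    refine Lp.ae_norm_eq_of_norm_add_eq_two hp _ _ hone (by rw [T.norm_map, hu]) ?_
    rw [← map_add, T.norm_map]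
    exact hu2
  set u : E := ‖e‖⁻¹ • e with u_def
  have hu : ‖u‖ = 1 := by
    rw [Submodule.coe_norm, u_def, Submodule.coe_smul, norm_smul, norm_inv,
      Real.norm_of_nonneg (norm_nonneg e)]
    exact inv_mul_cancel₀ he'
  have hTu : ∀ᵐ x ∂σ, ‖T (⟨1, h1⟩ : E) x‖ = ‖T u x‖ := by
    rcases ContinuousMap.norm_one_add_or_sub_eq_two (u : C(K, ℝ)) hu with h | h
    · exact key u hu h
    · filter_upwards [key (-u) ((norm_neg (u : C(K, ℝ))).trans hu) h, Lp.coeFn_neg (T u)] with x hx hx'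
      rw [hx, T.map_neg, hx', Pi.neg_apply, norm_neg]
  have hsmul : T u = ‖e‖⁻¹ • T e := map_smul T _ _
  filter_upwards [hTu, Lp.coeFn_smul ‖e‖⁻¹ (T e)] with x hx hx'
  rw [hx, hsmul, hx', Pi.smul_apply, norm_smul, norm_inv,
    Real.norm_of_nonneg (norm_nonneg e)]
  field_simp
end

section
/- Let $p>1$, $(X,\sigma)$ a finite measure space, and $F$ a real Banach space. Let $T$ be a linear isometry from $C(K)$ (for a compact metric space $K$) into the Lebesgue–Bochner space $L_p(X;F)$. If $C(K)$ is infinite-dimensional (in particular nontrivial), then the set of linear isometries from $C(K)$ to $F$ is nonempty; in particular, $F$ contains an isometric copy of $C(K)$. -/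
open MeasureTheory

section LpNorms

variable {X F : Type*} [MeasurableSpace X] {σ : Measure X} [NormedAddCommGroup F] {p : ℝ}

theorem integrable_norm_rpow_of_Lp (hp : 1 < p) (u : Lp F (ENNReal.ofReal p) σ) :
    Integrable (fun x => ‖u x‖ ^ p) σ := by
  have h := (Lp.memLp u).integrable_norm_rpow (by simp; linarith) ENNReal.ofReal_ne_top
  rwa [ENNReal.toReal_ofReal (by linarith)] at h

theorem integral_norm_rpow_eq_norm_rpow (hp : 1 < p) (u : Lp F (ENNReal.ofReal p) σ) :
    ∫ x, ‖u x‖ ^ p ∂σ = ‖u‖ ^ p := by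
  have hu := (Lp.memLp u).aestronglyMeasurable
  rw [Lp.norm_def, toReal_eLpNorm hu, lpNorm_eq_integral_norm_rpow_toReal (by simp; linarith)
    ENNReal.ofReal_ne_top hu, ENNReal.toReal_ofReal (by linarith),
    Real.rpow_inv_rpow (integral_nonneg fun x => by positivity) (by linarith)]

/-- Strict convexity of `t ↦ t ^ p`: if two unit vectors of `L_p(X; F)` have a sum of norm two,
then their pointwise norms agree almost everywhere. -/
theorem norm_ae_eq_of_norm_add_eq_two (hp : 1 < p) (u v : Lp F (ENNReal.ofReal p) σ)
    (hu : ‖u‖ = 1) (hv : ‖v‖ = 1) (huv : ‖u + v‖ = 2) :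
    ∀ᵐ x ∂σ, ‖u x‖ = ‖v x‖ := by
  have hp0 : 0 < p := by linarith
  have hconv (a b : ℝ) (ha : 0 ≤ a) (hb : 0 ≤ b) (hab : a ≠ b) :
      ((a + b) / 2) ^ p < (a ^ p + b ^ p) / 2 := by
    have h := (strictConvexOn_rpow hp).2 ha hb hab (half_pos one_pos) (half_pos one_pos)
      (add_halves 1)
    simp only [smul_eq_mul] at h
    rwa [← mul_add, ← mul_add, one_div_mul_eq_div, one_div_mul_eq_div] at h
  have hle (x : X) (hx : (u + v : Lp F (ENNReal.ofReal p) σ) x = u x + v x) :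
      (‖(u + v : Lp F (ENNReal.ofReal p) σ) x‖ ^ p) / 2 ^ p
        ≤ ((‖u x‖ + ‖v x‖) / 2) ^ p := by
    rw [Real.div_rpow (by positivity) (by norm_num), hx]
    gcongr
    exact norm_add_le _ _
  let D : X → ℝ := fun x => (‖u x‖ ^ p + ‖v x‖ ^ p) / 2 -
    (‖(u + v : Lp F (ENNReal.ofReal p) σ) x‖ ^ p) / 2 ^ p
  have hiu := integrable_norm_rpow_of_Lp hp u
  have hiv := integrable_norm_rpow_of_Lp hp v
  have hiw := integrable_norm_rpow_of_Lp hp (u + v)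
  have hD : Integrable D σ := ((hiu.add hiv).div_const 2).sub (hiw.div_const _)
  have hint : ∫ x, D x ∂σ = 0 := by
    have h : ∫ x, D x ∂σ = (∫ x, ‖u x‖ ^ p ∂σ + ∫ x, ‖v x‖ ^ p ∂σ) / 2 -
        (∫ x, ‖(u + v : Lp F (ENNReal.ofReal p) σ) x‖ ^ p ∂σ) / 2 ^ p := by
      rw [← integral_add hiu hiv, ← integral_div, ← integral_div,
        ← integral_sub (by exact (hiu.add hiv).div_const 2) (hiw.div_const _)]
    rw [h, integral_norm_rpow_eq_norm_rpow hp, integral_norm_rpow_eq_norm_rpow hp,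
      integral_norm_rpow_eq_norm_rpow hp, hu, hv, huv, Real.one_rpow, div_self (by positivity)]
    norm_num
  have hnonneg : 0 ≤ᵐ[σ] D := by
    filter_upwards [Lp.coeFn_add u v] with x hx
    refine sub_nonneg.2 ((hle x hx).trans ?_)
    rcases eq_or_ne ‖u x‖ ‖v x‖ with h | h
    · rw [h, add_self_div_two, add_self_div_two]
    · exact (hconv _ _ (norm_nonneg _) (norm_nonneg _) h).le
  filter_upwards [(integral_eq_zero_iff_of_nonneg_ae hnonneg hD).1 hint, Lp.coeFn_add u v]
    with x hx0 hx
  by_contra h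
  exact absurd (sub_eq_zero.1 hx0)
    ((hle x hx).trans_lt (hconv _ _ (norm_nonneg _) (norm_nonneg _) h)).ne'

end LpNorms

section Extension

variable {E F : Type*} [NormedAddCommGroup E] [NormedSpace ℝ E]
  [NormedAddCommGroup F] [NormedSpace ℝ F] [CompleteSpace F]

/-- A norm-preserving additive map on a dense subgroup extends to a linear isometry. -/
theorem nonempty_linearIsometry_of_dense (D : AddSubgroup E) (hD : Dense (D : Set E))
    (φ : D →+ F) (hφ : ∀ d, ‖φ d‖ = ‖d‖) : Nonempty (E →ₗᵢ[ℝ] F) := by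
  have hr : DenseRange ((↑) : D → E) := hD.denseRange_val
  have hiso : Isometry φ := AddMonoidHomClass.isometry_of_norm φ hφ
  have hc : Continuous (hD.extend φ) :=
    (uniformContinuous_uniformly_extend (isUniformInducing_val _) hr
      hiso.uniformContinuous).continuous
  have heq (d : D) : hD.extend φ d = φ d := hD.extend_eq hiso.continuous d
  have hadd (a b : E) : hD.extend φ (a + b) = hD.extend φ a + hD.extend φ b := by
    refine hr.induction_on₂ (isClosed_eq (by fun_prop) (by fun_prop)) (fun a b => ?_) a b
    rw [← D.coe_add, heq, heq, heq, map_add]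
  have hnorm (a : E) : ‖hD.extend φ a‖ = ‖a‖ := by
    refine hr.induction_on a (isClosed_eq (by fun_prop) (by fun_prop)) (fun a => ?_)
    rw [heq, hφ, AddSubgroup.coe_norm]
  exact ⟨⟨((AddMonoidHom.mk' _ hadd).toRealLinearMap hc).toLinearMap, hnorm⟩⟩

open TopologicalSpace in
theorem exists_countable_dense_addSubgroup (G : Type*) [NormedAddCommGroup G]
    [SeparableSpace G] : ∃ D : AddSubgroup G, Countable D ∧ Dense (D : Set G) := by
  let L : (ℕ →₀ ℤ) →ₗ[ℤ] G := Finsupp.linearCombination ℤ (denseSeq G)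
  refine ⟨L.toAddMonoidHom.range, (Set.countable_range L).to_subtype,
    (denseRange_denseSeq G).mono ?_⟩
  rintro _ ⟨n, rfl⟩
  exact ⟨Finsupp.single n 1, by simp [L]⟩

/-- If the pointwise norm of `T f` is always `‖f‖` times a fixed function not vanishing almost
everywhere, then evaluating `T` at a suitable point and rescaling gives a linear isometry. -/
theorem nonempty_linearIsometry_of_norm_ae_eq [TopologicalSpace.SeparableSpace E]
    {X : Type*} [MeasurableSpace X] {σ : Measure X} {q : ENNReal} [Fact (1 ≤ q)]
    (T : E →ₗᵢ[ℝ] Lp F q σ) (h : X → ℝ) (hh : ¬ ∀ᵐ x ∂σ, h x = 0)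
    (hT : ∀ f, ∀ᵐ x ∂σ, ‖T f x‖ = ‖f‖ * |h x|) : Nonempty (E →ₗᵢ[ℝ] F) := by
  obtain ⟨D, hDc, hD⟩ := exists_countable_dense_addSubgroup E
  have hn : ∀ᵐ x ∂σ, ∀ d : D, ‖T d x‖ = ‖(d : E)‖ * |h x| := ae_all_iff.2 fun d => hT d
  have ha : ∀ᵐ x ∂σ, ∀ c d : D, T ((c + d : D) : E) x = T c x + T d x := by
    refine ae_all_iff.2 fun c => ae_all_iff.2 fun d => ?_
    rw [D.coe_add, map_add]
    exact Lp.coeFn_add _ _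
  obtain ⟨x, hx, hnx, hax⟩ := ((Filter.not_eventually.1 hh).and_eventually (hn.and ha)).exists
  refine nonempty_linearIsometry_of_dense D hD
    (AddMonoidHom.mk' (fun d => (h x)⁻¹ • T d x) fun c d => ?_) fun d => ?_
  · rw [hax, smul_add]
  · have : |h x| ≠ 0 := abs_ne_zero.2 hx
    simp only [AddMonoidHom.mk'_apply]
    rw [norm_smul, hnx, norm_inv, Real.norm_eq_abs, AddSubgroup.coe_norm]
    field_simp

end Extension

theorem ContinuousMap.norm_add_one_eq_or {K : Type*} [TopologicalSpace K] [CompactSpace K]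
    [Nonempty K] (f : C(K, ℝ)) : ‖f + 1‖ = ‖f‖ + 1 ∨ ‖-f + 1‖ = ‖f‖ + 1 := by
  obtain ⟨k, -, hk⟩ := isCompact_univ.exists_isMaxOn Set.univ_nonempty
    (f.continuous.norm.continuousOn)
  have hfk : ‖f‖ = |f k| := le_antisymm
    ((f.norm_le (norm_nonneg _)).2 fun y => hk (Set.mem_univ y)) (f.norm_coe_le_norm k)
  have hkey (g : C(K, ℝ)) (hg : ‖g‖ = g k) : ‖g + 1‖ = ‖g‖ + 1 := by
    refine le_antisymm ((norm_add_le _ _).trans_eq (by rw [norm_one])) ?_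
    have := (le_abs_self _).trans ((g + 1).norm_coe_le_norm k)
    rw [hg]
    simpa using this
  rcases le_total 0 (f k) with h0 | h0
  · exact .inl (hkey f (by rw [hfk, abs_of_nonneg h0]))
  · right
    rw [hkey (-f) (by rw [norm_neg, hfk, abs_of_nonpos h0]; rfl), norm_neg]

/-- If `C(K)` (infinite-dimensional) embeds isometrically into `L_p(X; F)` with
`p > 1` and `σ` finite, then the set of linear isometries from `C(K)` to `F` is
nonempty, i.e. `F` contains an isometric copy of `C(K)`. -/
theorem C_K_embeds_in_F
    {K : Type*} [MetricSpace K] [CompactSpace K]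
    {F : Type*} [NormedAddCommGroup F] [NormedSpace ℝ F] [CompleteSpace F]
    {X : Type*} [MeasurableSpace X] (σ : Measure X) [IsFiniteMeasure σ]
    {p : ℝ} (hp : 1 < p) [Fact (1 ≤ ENNReal.ofReal p)]
    (T : C(K, ℝ) →ₗᵢ[ℝ] Lp F (ENNReal.ofReal p) σ)
    (hdim : ¬ FiniteDimensional ℝ C(K, ℝ)) :
    Nonempty (C(K, ℝ) →ₗᵢ[ℝ] F) := by
  have hK : Nonempty K := by
    by_contra hK
    rw [not_nonempty_iff] at hK
    have : Subsingleton C(K, ℝ) := ⟨fun f g => ContinuousMap.ext fun k => hK.elim k⟩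
    exact hdim inferInstance
  have hunit (g : C(K, ℝ)) (hg : ‖g‖ = 1) :
      ∀ᵐ x ∂σ, ‖T g x‖ = ‖T 1 x‖ := by
    have hpos (g : C(K, ℝ)) (hg : ‖g‖ = 1) (hg1 : ‖g + 1‖ = ‖g‖ + 1) :
        ∀ᵐ x ∂σ, ‖T g x‖ = ‖T 1 x‖ :=
      norm_ae_eq_of_norm_add_eq_two hp _ _ (by rw [T.norm_map, hg])
        (by rw [T.norm_map, norm_one]) (by rw [← map_add, T.norm_map, hg1, hg]; norm_num)
    rcases g.norm_add_one_eq_or with h | h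
    · exact hpos g hg h
    · have hneg := hpos (-g) (by rwa [norm_neg]) (by rwa [norm_neg])
      rw [map_neg] at hneg
      filter_upwards [hneg, Lp.coeFn_neg (T g)] with x hx hx'
      rw [← hx, hx', Pi.neg_apply, norm_neg]
  refine nonempty_linearIsometry_of_norm_ae_eq T (fun x => ‖T 1 x‖) (fun h0 => ?_) fun f => ?_
  · have hT1 : T 1 = 0 := (Lp.eq_zero_iff_ae_eq_zero).2 <| by
      filter_upwards [h0] with x hx using norm_eq_zero.1 hx
    exact one_ne_zero ((map_eq_zero_iff T T.injective).1 hT1)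
  · rcases eq_or_ne f 0 with rfl | hf
    · rw [map_zero]
      filter_upwards [Lp.coeFn_zero F (ENNReal.ofReal p) σ] with x hx
      rw [hx, Pi.zero_apply, norm_zero, norm_zero, zero_mul]
    · have hf' : ‖f‖ ≠ 0 := norm_ne_zero_iff.2 hf
      have hu := hunit (‖f‖⁻¹ • f) (by rw [norm_smul, norm_inv, norm_norm, inv_mul_cancel₀ hf'])
      rw [map_smul] at hu
      filter_upwards [hu, Lp.coeFn_smul ‖f‖⁻¹ (T f)] with x hx hx'
      rw [← hx, hx', Pi.smul_apply, norm_smul, norm_inv, norm_norm, abs_of_nonneg (by positivity),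
        mul_inv_cancel_left₀ hf']
end
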